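/- Every homeomorphism h of the Golomb space preserves monogenic multiplicative semigroups: h({aⁿ : n ≥ 1}) = {h(a)ⁿ : n ≥ 1} for all positive integers a. -/

import Mathlib

/-- The base of the Golomb topology: arithmetic progressions `{a + b*n : n ≥ 0}`
with coprime `a, b ≥ 1`, viewed inside the positive integers. -/
def golombBasis : Set (Set ℕ+) :=
  {S | ∃ a b : ℕ, 1 ≤ a ∧ 1 ≤ b ∧ Nat.Coprime a b ∧
    S = {x : ℕ+ | ∃ n : ℕ, (x : ℕ) = a + b * n}}

/-- The Golomb (relatively prime integer) topology on `ℕ+`. -/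
instance golombTopology : TopologicalSpace ℕ+ :=
  TopologicalSpace.generateFrom golombBasis

/-! ### Topological part -/

/-- The basic neighbourhood `x + cℕ`. -/
def gnb (x : ℕ+) (c : ℕ) : Set ℕ+ := {y : ℕ+ | ∃ n : ℕ, (y : ℕ) = x + c * n}

theorem gnb_self (x : ℕ+) (c : ℕ) : x ∈ gnb x c := ⟨0, by simp⟩

theorem gnb_open (x : ℕ+) (c : ℕ) (hc : 1 ≤ c) (h : Nat.Coprime x c) : IsOpen (gnb x c) :=
  TopologicalSpace.isOpen_generateFrom_of_mem ⟨x, c, x.pos, hc, h, rfl⟩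

theorem gnb_basis {U : Set ℕ+} (hU : IsOpen U) :
    ∀ x ∈ U, ∃ c : ℕ, 1 ≤ c ∧ Nat.Coprime x c ∧ gnb x c ⊆ U := by
  have hU' : TopologicalSpace.GenerateOpen golombBasis U := hU
  induction hU' with
  | basic s hs =>
    obtain ⟨a, b, ha, hb, hab, rfl⟩ := hs
    rintro x ⟨n, hn⟩
    refine ⟨b, hb, ?_, ?_⟩
    · rw [hn]; simpa using hab
    · rintro y ⟨m, hm⟩
      exact ⟨n + m, by rw [hm, hn]; ring⟩
  | univ => intro x _; exact ⟨1, le_rfl, by simp, Set.subset_univ _⟩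
  | inter s t hs ht ihs iht =>
    rintro x ⟨hxs, hxt⟩
    obtain ⟨c, hc, hxc, hcs⟩ := ihs hs x hxs
    obtain ⟨d, hd, hxd, hdt⟩ := iht ht x hxt
    refine ⟨c * d, Nat.mul_pos hc hd, Nat.Coprime.mul_right hxc hxd, ?_⟩
    rintro y ⟨m, hm⟩
    exact ⟨hcs ⟨d * m, by rw [hm]; ring⟩, hdt ⟨c * m, by rw [hm]; ring⟩⟩
  | sUnion S hS ih =>
    rintro x ⟨s, hs, hx⟩
    obtain ⟨c, hc, hxc, hcs⟩ := ih s hs (hS s hs) x hx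
    exact ⟨c, hc, hxc, fun y hy => ⟨s, hs, hcs hy⟩⟩

/-- Upper bound of the closure of a basic set. -/
theorem closure_gnb_sub (x : ℕ+) (r : ℕ) (hr : r.Prime) (k : ℕ) (t : ℕ+)
    (ht : t ∈ closure (gnb x (r ^ k))) : r ∣ t ∨ (t : ℕ) ≡ x [MOD r ^ k] := by
  by_contra hcon
  push Not at hcon
  obtain ⟨h1, h2⟩ := hcon
  have hco : Nat.Coprime t (r ^ k) :=
    Nat.Coprime.pow_right _ ((Nat.Prime.coprime_iff_not_dvd hr).2 h1).symm
  obtain ⟨y, ⟨n, hn⟩, ⟨m, hm⟩⟩ := mem_closure_iff.1 ht (gnb t (r ^ k))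
    (gnb_open _ _ (Nat.pow_pos hr.pos) hco) (gnb_self _ _)
  apply h2
  have e1 : (y : ℕ) ≡ t [MOD r ^ k] := by rw [hn]; simp [Nat.ModEq]
  have e2 : (y : ℕ) ≡ x [MOD r ^ k] := by rw [hm]; simp [Nat.ModEq]
  exact e1.symm.trans e2

/-- Lower bound of the closure of an open set. -/
theorem closure_open_sup {U : Set ℕ+} (hU : IsOpen U) (z : ℕ+) (hz : z ∈ U) :
    ∃ c : ℕ, 1 ≤ c ∧ Nat.Coprime z c ∧ ∀ t : ℕ+,
      (∀ r : ℕ, r.Prime → r ∣ c → r ∣ t ∨ ∀ k, r ^ k ∣ c → (t : ℕ) ≡ z [MOD r ^ k]) →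
      t ∈ closure U := by
  obtain ⟨c, hc, hzc, hcU⟩ := gnb_basis hU z hz
  refine ⟨c, hc, hzc, fun t ht => ?_⟩
  rw [mem_closure_iff]
  intro W hW htW
  obtain ⟨d, hd, htd, hdW⟩ := gnb_basis hW t htW
  have key : (t : ℕ) ≡ z [MOD Nat.gcd d c] := by
    rw [Nat.modEq_iff_dvd, Int.natCast_dvd, Nat.dvd_iff_prime_pow_dvd_dvd]
    intro p k hp hpk
    rcases Nat.eq_zero_or_pos k with rfl | hk
    · simp
    have hpg : p ∣ Nat.gcd d c := (dvd_pow_self p hk.ne').trans hpk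
    have hpd : p ∣ d := hpg.trans (Nat.gcd_dvd_left _ _)
    have hpc : p ∣ c := hpg.trans (Nat.gcd_dvd_right _ _)
    rcases ht p hp hpc with h1 | h1
    · exact absurd (Nat.dvd_gcd h1 hpd) (by rw [htd]; exact hp.one_lt.ne' ∘ Nat.dvd_one.1)
    · have := h1 k (hpk.trans (Nat.gcd_dvd_right _ _))
      rw [Nat.modEq_iff_dvd, Int.natCast_dvd] at this
      exact this
  obtain ⟨y, hy1, hy2⟩ := Nat.chineseRemainder' key
  have hcd : 0 < c * d := Nat.mul_pos hc hd
  let s : ℕ := y + c * d * (t + z)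
  have hs : (t : ℕ) + z ≤ s := by
    have : (t : ℕ) + z ≤ c * d * (t + z) := Nat.le_mul_of_pos_left _ hcd
    omega
  have hs1 : s ≡ t [MOD d] := by
    refine Nat.ModEq.trans ?_ hy1
    have : s = y + d * (c * (t + z)) := by simp only [s]; ring
    rw [this]; simp [Nat.ModEq]
  have hs2 : s ≡ z [MOD c] := by
    refine Nat.ModEq.trans ?_ hy2
    have : s = y + c * (d * (t + z)) := by simp only [s]; ring
    rw [this]; simp [Nat.ModEq]
  have htp := t.pos
  refine ⟨⟨s, by omega⟩, hdW ?_, hcU ?_⟩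
  · obtain ⟨n, hn⟩ := (Nat.modEq_iff_dvd' (by omega)).1 hs1.symm
    exact ⟨n, by simp only [PNat.mk_coe]; omega⟩
  · obtain ⟨n, hn⟩ := (Nat.modEq_iff_dvd' (by omega)).1 hs2.symm
    exact ⟨n, by simp only [PNat.mk_coe]; omega⟩

/-- `V` belongs to the filter generated by closures of neighbourhoods of `x, y, z`. -/
def GF (x y z : ℕ+) (V : Set ℕ+) : Prop :=
  ∃ U₁ U₂ U₃ : Set ℕ+, IsOpen U₁ ∧ IsOpen U₂ ∧ IsOpen U₃ ∧ x ∈ U₁ ∧ y ∈ U₂ ∧ z ∈ U₃ ∧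
    ∀ t, t ∈ closure U₁ → t ∈ closure U₂ → t ∈ closure U₃ → t ∈ V

theorem GF.image (h : ℕ+ ≃ₜ ℕ+) {x y z : ℕ+} {V : Set ℕ+} (H : GF x y z V) :
    GF (h x) (h y) (h z) (h '' V) := by
  obtain ⟨U₁, U₂, U₃, o1, o2, o3, m1, m2, m3, H⟩ := H
  refine ⟨h '' U₁, h '' U₂, h '' U₃, h.isOpenMap _ o1, h.isOpenMap _ o2, h.isOpenMap _ o3,
    ⟨x, m1, rfl⟩, ⟨y, m2, rfl⟩, ⟨z, m3, rfl⟩, ?_⟩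
  intro t
  rw [← h.image_closure, ← h.image_closure, ← h.image_closure]
  rintro ⟨a, ha, rfl⟩ ⟨b, hb, hb'⟩ ⟨c, hc, hc'⟩
  obtain rfl := h.injective hb'
  obtain rfl := h.injective hc'
  exact ⟨_, H _ ha hb hc, rfl⟩

theorem GF.mono {x y z : ℕ+} {V W : Set ℕ+} (H : GF x y z V) (hVW : V ⊆ W) : GF x y z W := by
  obtain ⟨U₁, U₂, U₃, o1, o2, o3, m1, m2, m3, H⟩ := H
  exact ⟨U₁, U₂, U₃, o1, o2, o3, m1, m2, m3, fun t a b c => hVW (H t a b c)⟩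

theorem GF.univ (x y z : ℕ+) : GF x y z Set.univ :=
  ⟨Set.univ, Set.univ, Set.univ, isOpen_univ, isOpen_univ, isOpen_univ, trivial, trivial, trivial,
    fun _ _ _ _ => trivial⟩

theorem GF.inter {x y z : ℕ+} {V W : Set ℕ+} (H : GF x y z V) (H' : GF x y z W) :
    GF x y z (V ∩ W) := by
  obtain ⟨U₁, U₂, U₃, o1, o2, o3, m1, m2, m3, H⟩ := H
  obtain ⟨W₁, W₂, W₃, p1, p2, p3, n1, n2, n3, H'⟩ := H'
  refine ⟨U₁ ∩ W₁, U₂ ∩ W₂, U₃ ∩ W₃, o1.inter p1, o2.inter p2, o3.inter p3,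
    ⟨m1, n1⟩, ⟨m2, n2⟩, ⟨m3, n3⟩, fun t a b c => ⟨H t ?_ ?_ ?_, H' t ?_ ?_ ?_⟩⟩
  · exact closure_mono Set.inter_subset_left a
  · exact closure_mono Set.inter_subset_left b
  · exact closure_mono Set.inter_subset_left c
  · exact closure_mono Set.inter_subset_right a
  · exact closure_mono Set.inter_subset_right b
  · exact closure_mono Set.inter_subset_right c

theorem GF.swap12 {x y z : ℕ+} {V : Set ℕ+} (H : GF x y z V) : GF y x z V := by
  obtain ⟨U₁, U₂, U₃, o1, o2, o3, m1, m2, m3, H⟩ := H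
  exact ⟨U₂, U₁, U₃, o2, o1, o3, m2, m1, m3, fun t a b c => H t b a c⟩

theorem GF.swap23 {x y z : ℕ+} {V : Set ℕ+} (H : GF x y z V) : GF x z y V := by
  obtain ⟨U₁, U₂, U₃, o1, o2, o3, m1, m2, m3, H⟩ := H
  exact ⟨U₁, U₃, U₂, o1, o3, o2, m1, m3, m2, fun t a b c => H t a c b⟩

theorem GF.gnb (x y z : ℕ+) (r : ℕ) (hr : r.Prime) (k : ℕ) (hx : ¬ r ∣ x) :
    GF x y z {t : ℕ+ | r ∣ t ∨ (t : ℕ) ≡ x [MOD r ^ k]} := by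
  have hco : Nat.Coprime x (r ^ k) :=
    Nat.Coprime.pow_right _ ((Nat.Prime.coprime_iff_not_dvd hr).2 hx).symm
  exact ⟨_root_.gnb x (r ^ k), Set.univ, Set.univ, gnb_open _ _ (Nat.pow_pos hr.pos) hco,
    isOpen_univ, isOpen_univ, gnb_self _ _, trivial, trivial,
    fun t a _ _ => closure_gnb_sub x r hr k t a⟩

/-- Two distinct points coprime to `r` give `rℕ`. -/
theorem GF.two (x y z : ℕ+) (hxy : x ≠ y) (r : ℕ) (hr : r.Prime) (hx : ¬ r ∣ x) (hy : ¬ r ∣ y) :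
    GF x y z {t : ℕ+ | r ∣ t} := by
  have h1 := GF.gnb x y z r hr (x + y) hx
  have h2 := (GF.gnb y x z r hr (x + y) hy).swap12
  refine (h1.inter h2).mono ?_
  rintro t ⟨a, b⟩
  rcases a with a | a
  · exact a
  rcases b with b | b
  · exact b
  exfalso
  apply hxy
  have hlt : (x : ℕ) + y < r ^ ((x : ℕ) + y) := Nat.lt_pow_self hr.one_lt
  exact PNat.coe_injective (Nat.ModEq.eq_of_lt_of_lt (a.symm.trans b) (by omega) (by omega))

theorem GF.finset {x y z : ℕ+} (S : Finset ℕ) (H : ∀ r ∈ S, GF x y z {t : ℕ+ | r ∣ t}) :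
    GF x y z {t : ℕ+ | ∀ r ∈ S, r ∣ t} := by
  induction S using Finset.induction_on with
  | empty => exact (GF.univ x y z).mono (by intro t _; simp)
  | insert a s _ ih =>
    refine ((H a (by simp)).inter (ih fun r hr => H r (by simp [hr]))).mono ?_
    rintro t ⟨h1, h2⟩ r hr
    rcases Finset.mem_insert.1 hr with rfl | hr
    · exact h1
    · exact h2 r hr

/-- Points in any set of the filter with a prescribed residue. -/
theorem GF.point {x y z : ℕ+} {V : Set ℕ+} (H : GF x y z V) (p : ℕ) (hp : p.Prime) (a : ℕ)
    (ha : ¬ p ∣ a) (hx : p ∣ x ∨ (x : ℕ) = a) (hy : p ∣ y ∨ (y : ℕ) = a)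
    (hz : p ∣ z ∨ (z : ℕ) = a) (k : ℕ) : ∃ t ∈ V, ¬ p ∣ t ∧ (t : ℕ) ≡ a [MOD p ^ k] := by
  obtain ⟨U₁, U₂, U₃, o1, o2, o3, m1, m2, m3, H⟩ := H
  obtain ⟨c₁, hc₁, cop₁, H₁⟩ := closure_open_sup o1 x m1
  obtain ⟨c₂, hc₂, cop₂, H₂⟩ := closure_open_sup o2 y m2
  obtain ⟨c₃, hc₃, cop₃, H₃⟩ := closure_open_sup o3 z m3
  have hc : c₁ * c₂ * c₃ ≠ 0 := by positivity
  obtain ⟨K, M, hM, hKM⟩ := Nat.exists_eq_pow_mul_and_not_dvd hc p hp.ne_one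
  have hco : Nat.Coprime (p ^ (K + k + 1)) M :=
    Nat.Coprime.pow_left _ ((Nat.Prime.coprime_iff_not_dvd hp).2 hM)
  obtain ⟨t, ht1, ht2⟩ := Nat.chineseRemainder hco a 0
  have hta : t ≡ a [MOD p] := ht1.of_dvd (dvd_pow_self p (by omega))
  have hpt : ¬ p ∣ t := fun h => ha ((hta.dvd_iff dvd_rfl).1 h)
  have ht0 : 0 < t := Nat.pos_of_ne_zero (fun h => hpt (h ▸ dvd_zero p))
  have hMt : M ∣ t := (Nat.modEq_zero_iff_dvd).1 ht2
  have gen : ∀ (w : ℕ+) (c : ℕ), c ∣ c₁ * c₂ * c₃ → Nat.Coprime w c → (p ∣ w ∨ (w : ℕ) = a) →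
      ∀ r : ℕ, r.Prime → r ∣ c → r ∣ t ∨ ∀ k, r ^ k ∣ c → t ≡ w [MOD r ^ k] := by
    intro w c hcc hwc hw r hr hrc
    by_cases hrp : r = p
    · subst hrp
      right
      intro j hj
      rcases hw with hw | hw
      · exact absurd (Nat.dvd_gcd hw hrc) (by rw [hwc]; exact hp.one_lt.ne' ∘ Nat.dvd_one.1)
      rw [hw]
      refine ht1.of_dvd ?_
      have h1 : r ^ j ∣ r ^ K * M := hKM ▸ hj.trans hcc
      have h2 : r ^ j ∣ r ^ K := Nat.Coprime.dvd_of_dvd_mul_right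
        (Nat.Coprime.pow_left _ ((Nat.Prime.coprime_iff_not_dvd hp).2 hM)) h1
      exact h2.trans (pow_dvd_pow _ (by omega))
    · left
      have h1 : r ∣ p ^ K * M := hKM ▸ hrc.trans hcc
      rcases hr.dvd_mul.1 h1 with h2 | h2
      · exact absurd ((Nat.prime_dvd_prime_iff_eq hr hp).1 (hr.dvd_of_dvd_pow h2)) hrp
      · exact h2.trans hMt
  refine ⟨⟨t, ht0⟩, H _ (H₁ _ ?_) (H₂ _ ?_) (H₃ _ ?_), hpt, ht1.of_dvd (pow_dvd_pow _ (by omega))⟩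
  · exact gen x c₁ ⟨c₂ * c₃, by ring⟩ cop₁ hx
  · exact gen y c₂ ⟨c₁ * c₃, by ring⟩ cop₂ hy
  · exact gen z c₃ ⟨c₁ * c₂, by ring⟩ cop₃ hz

/-- Topological characterization of pairwise coprime triples. -/
def PC (x y z : ℕ+) : Prop := ∀ W : Set ℕ+, IsOpen W → W.Nonempty → GF x y z (closure W)

theorem PC.image (h : ℕ+ ≃ₜ ℕ+) {x y z : ℕ+} (H : PC x y z) : PC (h x) (h y) (h z) := by
  intro W hW hne
  have h1 := (H (h ⁻¹' W) (hW.preimage h.continuous)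
    (hne.preimage h.surjective)).image h
  refine h1.mono ?_
  rw [h.image_closure, Set.image_preimage_eq _ h.surjective]

theorem PC.swap12 {x y z : ℕ+} (H : PC x y z) : PC y x z := fun W a b => (H W a b).swap12
theorem PC.swap23 {x y z : ℕ+} (H : PC x y z) : PC x z y := fun W a b => (H W a b).swap23

theorem PC.coprime {x y z : ℕ+} (H : PC x y z) : Nat.Coprime x y := by
  by_contra hcon
  obtain ⟨p, hp, hpx, hpy⟩ := Nat.Prime.not_coprime_iff_dvd.1 hcon
  obtain ⟨a, ha, haz⟩ : ∃ a : ℕ, ¬ p ∣ a ∧ (p ∣ z ∨ (z : ℕ) = a) := by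
    by_cases h : p ∣ z
    · exact ⟨1, hp.one_lt.ne' ∘ Nat.dvd_one.1, Or.inl h⟩
    · exact ⟨z, h, Or.inr rfl⟩
  have hb : ¬ p ∣ a + p := by simpa using ha
  let w : ℕ+ := ⟨a + p, by have := hp.pos; omega⟩
  have hcop : Nat.Coprime w (p ^ 2) :=
    Nat.Coprime.pow_right _ ((Nat.Prime.coprime_iff_not_dvd hp).2 hb).symm
  obtain ⟨t, ht, hpt, hta⟩ := (H (gnb w (p ^ 2)) (gnb_open _ _ (Nat.pow_pos hp.pos) hcop)
    ⟨w, gnb_self _ _⟩).point p hp a ha (Or.inl hpx) (Or.inl hpy) haz 2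
  rcases closure_gnb_sub w p hp 2 t ht with h1 | h1
  · exact hpt h1
  · have h2 : a ≡ a + p [MOD p ^ 2] := hta.symm.trans h1
    have h3 := (Nat.modEq_iff_dvd' (by omega)).1 h2
    simp only [Nat.add_sub_cancel_left] at h3
    have := Nat.le_of_dvd hp.pos h3
    have := hp.one_lt
    nlinarith

theorem PC_of_coprime {x y z : ℕ+} (hxy : x ≠ y) (hxz : x ≠ z) (hyz : y ≠ z)
    (cxy : Nat.Coprime x y) (cxz : Nat.Coprime x z) (cyz : Nat.Coprime y z) : PC x y z := by
  rintro W hW ⟨w, hw⟩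
  obtain ⟨c, hc, hwc, H⟩ := closure_open_sup hW w hw
  refine (GF.finset (x := x) (y := y) (z := z) c.primeFactors ?_).mono ?_
  · intro r hr
    have hr := Nat.prime_of_mem_primeFactors hr
    have no : ∀ u v : ℕ, Nat.Coprime u v → r ∣ u → ¬ r ∣ v := fun u v huv h1 h2 =>
      hr.one_lt.ne' (Nat.dvd_one.1 (huv ▸ Nat.dvd_gcd h1 h2))
    by_cases hx : r ∣ x
    · exact (GF.two y z x hyz r hr (no _ _ cxy hx) (no _ _ cxz hx)).swap23.swap12
    · by_cases hy : r ∣ y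
      · exact (GF.two x z y hxz r hr hx (no _ _ cyz hy)).swap23
      · exact GF.two x y z hxy r hr hx hy
  · intro t ht
    exact H t fun r hr hrc => Or.inl (ht r (Nat.mem_primeFactors.2 ⟨hr, hrc, by omega⟩))

theorem PC_one_iff (z : ℕ+) : z = 1 ↔ ∀ x, x ≠ z → ∃ y, PC z x y := by
  constructor
  · rintro rfl x hx
    have hx1 : (x : ℕ) ≠ 1 := fun h => hx (PNat.coe_injective h)
    refine ⟨x + 1, PC_of_coprime hx.symm ?_ ?_ ?_ ?_ ?_⟩
    · intro h
      have := congrArg PNat.val h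
      have := x.pos
      simp at *
    · intro h
      have := congrArg PNat.val h
      simp at this
    · simp
    · simp
    · simp
  · intro H
    by_contra hz
    obtain ⟨y, hy⟩ := H (z * z) (by
      intro h
      apply hz
      exact mul_eq_right.1 h)
    have := hy.coprime
    rw [PNat.mul_coe, Nat.coprime_mul_iff_right, and_self, Nat.coprime_self] at this
    exact hz (PNat.coe_injective this)

theorem homeo_one (h : ℕ+ ≃ₜ ℕ+) : h 1 = 1 := by
  rw [PC_one_iff]
  intro x hx
  obtain ⟨y, hy⟩ := (PC_one_iff 1).1 rfl (h.symm x) (by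
    intro h1; apply hx; rw [← h1]; simp)
  exact ⟨h y, by simpa using hy.image h⟩

theorem homeo_coprime (h : ℕ+ ≃ₜ ℕ+) {x y : ℕ+} (hxy : Nat.Coprime x y) :
    Nat.Coprime (h x) (h y) := by
  by_cases hx : x = 1
  · subst hx; simp [homeo_one h]
  by_cases hy : y = 1
  · subst hy; simp [homeo_one h]
  have hne : x ≠ y := by
    rintro rfl
    rw [Nat.coprime_self] at hxy
    exact hx (PNat.coe_injective hxy)
  exact ((PC_of_coprime hne hx hy hxy (by simp) (by simp)).image h).coprime

/-- `y` lies in the `p`-adic closure of the powers of `q`. -/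
def Cl (p q y : ℕ) : Prop := ∀ m : ℕ, ∃ i : ℕ, 1 ≤ i ∧ q ^ i ≡ y [MOD p ^ m]

/-- Topological description of the `p`-adic closure. -/
theorem padic_to_top {p : ℕ} (hp : p.Prime) {x u v : ℕ+} (huv : u ≠ v)
    (hu : ∀ r : ℕ, r.Prime → r ∣ u → r = p) (hv : ∀ r : ℕ, r.Prime → r ∣ v → r = p)
    (hu' : p ∣ u) (hv' : p ∣ v)
    (A : Set ℕ+) (hA : ∀ a ∈ A, ¬ p ∣ a)
    (hcl : ∀ k, ∃ a ∈ A, (a : ℕ) ≡ x [MOD p ^ k]) (V : Set ℕ+) (hV : GF x u v V) :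
    ∃ a ∈ A, GF a u v V := by
  obtain ⟨U₁, U₂, U₃, o1, o2, o3, m1, m2, m3, H⟩ := hV
  obtain ⟨c₁, hc₁, cop₁, H₁⟩ := closure_open_sup o1 x m1
  obtain ⟨c₂, hc₂, cop₂, H₂⟩ := closure_open_sup o2 u m2
  obtain ⟨c₃, hc₃, cop₃, H₃⟩ := closure_open_sup o3 v m3
  obtain ⟨a, haA, hax⟩ := hcl c₁
  refine ⟨a, haA, ?_⟩
  have g1 := GF.gnb a u v p hp c₁ (hA a haA)
  have g2 := GF.finset (x := a) (y := u) (z := v) ((c₁ * c₂ * c₃).primeFactors.erase p) (by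
    intro r hr
    have hr2 := Nat.prime_of_mem_primeFactors (Finset.mem_of_mem_erase hr)
    have hrp := Finset.ne_of_mem_erase hr
    exact (GF.two u v a huv r hr2 (fun h => hrp (hu r hr2 h))
      (fun h => hrp (hv r hr2 h))).swap23.swap12)
  have hc : c₁ * c₂ * c₃ ≠ 0 := by positivity
  refine (g1.inter g2).mono ?_
  rintro t ⟨ht1, ht2⟩
  have hne : ∀ r : ℕ, r.Prime → r ∣ c₁ * c₂ * c₃ → r ≠ p → r ∣ t := fun r hr hrc hrp =>
    ht2 r (Finset.mem_erase.2 ⟨hrp, Nat.mem_primeFactors.2 ⟨hr, hrc, hc⟩⟩)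
  refine H t (H₁ t ?_) (H₂ t ?_) (H₃ t ?_)
  · intro r hr hrc
    by_cases hrp : r = p
    · subst hrp
      rcases ht1 with ht1 | ht1
      · exact Or.inl ht1
      right
      intro k hk
      refine (ht1.trans hax).of_dvd (pow_dvd_pow _ ?_)
      have h1 := Nat.le_of_dvd hc₁ hk
      have h2 : k < r ^ k := Nat.lt_pow_self hr.one_lt
      omega
    · exact Or.inl (hne r hr (hrc.trans ⟨c₂ * c₃, by ring⟩) hrp)
  · intro r hr hrc
    refine Or.inl (hne r hr (hrc.trans ⟨c₁ * c₃, by ring⟩) ?_)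
    rintro rfl
    exact hr.one_lt.ne' (Nat.dvd_one.1 (cop₂ ▸ Nat.dvd_gcd hu' hrc))
  · intro r hr hrc
    refine Or.inl (hne r hr (hrc.trans ⟨c₁ * c₂, by ring⟩) ?_)
    rintro rfl
    exact hr.one_lt.ne' (Nat.dvd_one.1 (cop₃ ▸ Nat.dvd_gcd hv' hrc))

theorem top_to_padic {p : ℕ} (hp : p.Prime) {x u v : ℕ+} (hx : ¬ p ∣ x)
    (hu' : p ∣ u) (hv' : p ∣ v)
    (A : Set ℕ+) (hA : ∀ a ∈ A, ¬ p ∣ a)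
    (H : ∀ V, GF x u v V → ∃ a ∈ A, GF a u v V) (k : ℕ) : ∃ a ∈ A, (a : ℕ) ≡ x [MOD p ^ k] := by
  obtain ⟨a, haA, ha⟩ := H _ (GF.gnb x u v p hp k hx)
  refine ⟨a, haA, ?_⟩
  obtain ⟨t, ht, hpt, hta⟩ := ha.point p hp a (hA a haA) (Or.inr rfl) (Or.inl hu') (Or.inl hv') k
  rcases ht with ht | ht
  · exact absurd ht hpt
  · exact hta.symm.trans ht

/-! ### Arithmetic part -/

theorem lte_step {p : ℕ} (hp : p.Prime) {k : ℕ} (hk : 3 ≤ p ^ k) (x : ℤ) :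
    ∃ y : ℤ, (1 + (p : ℤ) ^ k * x) ^ p = 1 + (p : ℤ) ^ (k + 1) * (x + p * y) := by
  have hk0 : k ≠ 0 := by rintro rfl; simp at hk
  have hkp : k + 2 ≤ k * p := by
    have h2 := hp.two_le
    rcases Nat.lt_or_ge k 2 with h | h
    · obtain rfl : k = 1 := by omega
      simp at hk ⊢; omega
    · nlinarith
  obtain ⟨y, hy⟩ := ZMod.exists_one_add_mul_pow_prime_eq (R := ℤ) (u := (p : ℤ) ^ k) (v := p) hp
    (dvd_pow_self _ hk0) (by
      rw [← pow_mul]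
      have : (p : ℤ) * p ^ k * p = p ^ (k + 2) := by ring
      rw [this]
      exact pow_dvd_pow _ hkp) x
  exact ⟨y, by rw [hy]; ring⟩

theorem pow_prime_level {p : ℕ} (hp : p.Prime) {k : ℕ} (hk : 3 ≤ p ^ k) {x : ℕ}
    (hx : x ≡ 1 [MOD p ^ k]) : x ^ p ≡ 1 [MOD p ^ (k + 1)] := by
  obtain ⟨u, hu⟩ : (p : ℤ) ^ k ∣ (x : ℤ) - 1 := by
    have := (Nat.modEq_iff_dvd.1 hx.symm)
    push_cast at this
    exact this
  obtain ⟨y, hy⟩ := lte_step hp hk u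
  apply Nat.ModEq.symm
  rw [Nat.modEq_iff_dvd]
  push_cast
  rw [show (x : ℤ) = 1 + (p : ℤ) ^ k * u by linarith, hy]
  exact ⟨u + p * y, by ring⟩

theorem lte_iter {p : ℕ} (hp : p.Prime) {n : ℕ} (hn : 3 ≤ p ^ n) (g : ℤ) (u : ℤ)
    (hu : ¬ (p : ℤ) ∣ u) (hg : g = 1 + (p : ℤ) ^ n * u) (t : ℕ) :
    ∃ w : ℤ, ¬ (p : ℤ) ∣ w ∧ g ^ (p ^ t) = 1 + (p : ℤ) ^ (n + t) * w := by
  induction t with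
  | zero => exact ⟨u, hu, by simpa using hg⟩
  | succ t ih =>
    obtain ⟨w, hw, h⟩ := ih
    obtain ⟨y, hy⟩ := lte_step hp (k := n + t)
      (hn.trans (Nat.pow_le_pow_right hp.pos (by omega))) w
    refine ⟨w + p * y, fun hd => hw ?_, ?_⟩
    · exact (dvd_add_left (dvd_mul_right _ _)).1 hd
    · rw [pow_succ, pow_mul, h, hy, ← add_assoc]

theorem one_add_pow_approx (P w : ℤ) (j : ℕ) :
    ∃ z : ℤ, (1 + P * w) ^ j = 1 + j * (P * w) + P * P * z := by
  induction j with
  | zero => exact ⟨0, by simp⟩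
  | succ j ih =>
    obtain ⟨z, hz⟩ := ih
    refine ⟨z + z * (P * w) + j * w * w, ?_⟩
    rw [pow_succ, hz]; push_cast; ring

/-- Key approximation lemma. -/
theorem cl_of_modEq {p : ℕ} (hp : p.Prime) {n : ℕ} (hn : 3 ≤ p ^ n) {q e j y : ℕ} (he : 1 ≤ e)
    (h1 : q ^ e ≡ 1 [MOD p ^ n]) (h2 : ¬ q ^ e ≡ 1 [MOD p ^ (n + 1)])
    (hy : q ^ j ≡ y [MOD p ^ n]) : Cl p q y := by
  have hn0 : n ≠ 0 := by rintro rfl; simp at hn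
  have hpZ : Prime (p : ℤ) := Nat.prime_iff_prime_int.1 hp
  obtain ⟨u, hu⟩ : (p : ℤ) ^ n ∣ (q : ℤ) ^ e - 1 := by
    have := (Nat.modEq_iff_dvd.1 h1.symm)
    push_cast at this; exact this
  have hpu : ¬ (p : ℤ) ∣ u := by
    rintro ⟨v, rfl⟩
    apply h2
    apply Nat.ModEq.symm
    rw [Nat.modEq_iff_dvd]
    push_cast
    exact ⟨v, by rw [hu]; ring⟩
  have hpq : ¬ (p : ℤ) ∣ (q : ℤ) := by
    intro h
    have a1 : (p : ℤ) ∣ (q : ℤ) ^ e := dvd_pow h (by omega)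
    have a2 : (p : ℤ) ∣ (q : ℤ) ^ e - 1 := (dvd_pow_self _ hn0).trans ⟨u, hu⟩
    have : (p : ℤ) ∣ 1 := by
      have := dvd_sub a1 a2
      simpa using this
    exact hpZ.not_isUnit (isUnit_of_dvd_one this)
  have main : ∀ t : ℕ, ∃ i : ℕ, 1 ≤ i ∧ (p : ℤ) ^ (n + t) ∣ (q : ℤ) ^ i - y := by
    intro t
    induction t with
    | zero =>
      refine ⟨j + e, by omega, ?_⟩
      have := Nat.modEq_iff_dvd.1 ((Nat.ModEq.mul hy h1).symm)
      push_cast at this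
      rw [Nat.add_zero, pow_add (q : ℤ)]
      rwa [mul_one] at this
    | succ t ih =>
      obtain ⟨i, hi, w, hw⟩ := ih
      obtain ⟨c, hc, hce⟩ := lte_iter hp hn ((q : ℤ) ^ e) u hpu (by linarith) t
      have hcop : IsCoprime (c * (q : ℤ) ^ i) (p : ℤ) := by
        rw [isCoprime_comm, hpZ.coprime_iff_not_dvd]
        intro h
        rcases hpZ.dvd_or_dvd h with h | h
        · exact hc h
        · exact hpq (hpZ.dvd_of_dvd_pow h)
      obtain ⟨a, b, hab⟩ := hcop
      have hp0 : (0 : ℤ) < p := by exact_mod_cast hp.pos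
      let s : ℤ := (-(w * a)) % p
      have hs0 : 0 ≤ s := Int.emod_nonneg _ hp0.ne'
      obtain ⟨J, hJ⟩ := Int.eq_ofNat_of_zero_le hs0
      obtain ⟨d, hd⟩ : (p : ℤ) ∣ w + J * (c * (q : ℤ) ^ i) := by
        have e1 : (p : ℤ) ∣ -(w * a) - s := Int.dvd_self_sub_emod
        obtain ⟨f, hf⟩ := e1
        have : w + J * (c * (q : ℤ) ^ i) = p * (w * b - f * (c * (q : ℤ) ^ i)) := by
          have : (J : ℤ) = -(w * a) - p * f := by
            have : (J : ℤ) = s := hJ.symm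
            rw [this]; linarith
          rw [this]
          linear_combination (-w) * hab
        exact ⟨_, this⟩
      obtain ⟨z, hz⟩ := one_add_pow_approx ((p : ℤ) ^ (n + t)) c J
      refine ⟨i + e * p ^ t * J, by omega, ?_⟩
      have e2 : (q : ℤ) ^ (i + e * p ^ t * J) - y =
          (p : ℤ) ^ (n + t) * (p * d) + (p : ℤ) ^ (n + t) * (p : ℤ) ^ (n + t) * (z * q ^ i) := by
        rw [pow_add, pow_mul, pow_mul, hce, hz, ← hd]
        linear_combination hw
      rw [e2]
      apply dvd_add
      · exact ⟨d, by ring⟩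
      · rw [← pow_add]
        exact Dvd.dvd.mul_right (pow_dvd_pow _ (by omega)) _
  intro m
  obtain ⟨i, hi, h⟩ := main m
  refine ⟨i, hi, ?_⟩
  apply Nat.ModEq.symm
  rw [Nat.modEq_iff_dvd]
  push_cast
  exact (pow_dvd_pow _ (by omega)).trans h

theorem Cl.pow {p q y : ℕ} (h : Cl p q y) (n : ℕ) (hn : 1 ≤ n) : Cl p q (y ^ n) := by
  intro m
  obtain ⟨i, hi, h⟩ := h m
  exact ⟨i * n, Nat.mul_pos hi hn, by rw [pow_mul]; exact h.pow n⟩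

theorem Cl.one_mod {p q y : ℕ} (h : Cl p q y) {n : ℕ} (hq : q ≡ 1 [MOD p ^ n]) :
    y ≡ 1 [MOD p ^ n] := by
  obtain ⟨i, hi, h⟩ := h n
  have := hq.pow i
  rw [one_pow] at this
  exact h.symm.trans this

/-- Principal subgroups. -/
theorem cl_exact {p : ℕ} (hp : p.Prime) {n : ℕ} (hn : 3 ≤ p ^ n) {q : ℕ}
    (h1 : q ≡ 1 [MOD p ^ n]) (h2 : ¬ q ≡ 1 [MOD p ^ (n + 1)]) (y : ℕ) :
    Cl p q y ↔ y ≡ 1 [MOD p ^ n] := by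
  constructor
  · intro h; exact h.one_mod h1
  · intro h
    exact cl_of_modEq hp hn (e := 1) (j := 0) le_rfl (by simpa using h1) (by simpa using h2)
      (by simpa using h.symm)

theorem exists_exact {p : ℕ} (hp : p.Prime) {n : ℕ} (hn : 1 ≤ n) :
    ∃ q : ℕ, q.Prime ∧ q ≠ p ∧ q ≡ 1 [MOD p ^ n] ∧ ¬ q ≡ 1 [MOD p ^ (n + 1)] := by
  have hco : Nat.Coprime (1 + p ^ n) (p ^ (n + 1)) := by
    apply Nat.Coprime.pow_right
    apply Nat.Coprime.symm
    rw [Nat.Prime.coprime_iff_not_dvd hp]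
    intro h
    have := (Nat.dvd_add_left (dvd_pow_self p (by omega : n ≠ 0))).1 h
    exact hp.one_lt.ne' (Nat.dvd_one.1 this)
  obtain ⟨q, hqp, hq, hmod⟩ := Nat.forall_exists_prime_gt_and_modEq p (q := p ^ (n + 1))
    (a := 1 + p ^ n) (pow_pos hp.pos _).ne' hco
  refine ⟨q, hq, by omega, ?_, ?_⟩
  · have := hmod.of_dvd (pow_dvd_pow p (Nat.le_succ n))
    refine this.trans ?_
    simp [Nat.ModEq]
  · intro h
    have h3 : 1 ≡ 1 + p ^ n [MOD p ^ (n + 1)] := h.symm.trans hmod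
    have h4 := (Nat.modEq_iff_dvd' (by omega)).1 h3
    simp only [Nat.add_sub_cancel_left] at h4
    have := Nat.le_of_dvd (pow_pos hp.pos _) h4
    have h5 : p ^ n < p ^ (n + 1) := Nat.pow_lt_pow_right hp.one_lt (by omega)
    omega

theorem exists_level {p : ℕ} (hp : p.Prime) {x n : ℕ} (hx : 2 ≤ x) (h : x ≡ 1 [MOD p ^ n]) :
    ∃ k, n ≤ k ∧ x ≡ 1 [MOD p ^ k] ∧ ¬ x ≡ 1 [MOD p ^ (k + 1)] := by
  by_contra hcon
  push Not at hcon
  have : ∀ k, x ≡ 1 [MOD p ^ (n + k)] := by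
    intro k
    induction k with
    | zero => exact h
    | succ k ih => exact hcon (n + k) (Nat.le_add_right n k) ih
  have h1 := this x
  have h2 : x < p ^ (n + x) :=
    (Nat.lt_pow_self hp.one_lt).trans_le (Nat.pow_le_pow_right hp.pos (by omega))
  have := Nat.ModEq.eq_of_lt_of_lt h1 h2 (by omega)
  omega

def Chain (p q : ℕ) : Prop := ∀ r s : ℕ, r.Prime → r ≠ p → s.Prime → s ≠ p →
  Cl p q r → Cl p q s → Cl p r s ∨ Cl p s r

theorem chain_of_one {p : ℕ} (hp : p.Prime) (hp2 : p ≠ 2) {q : ℕ}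
    (h : q ≡ 1 [MOD p]) : Chain p q := by
  have hp3 : 3 ≤ p := by have := hp.two_le; omega
  intro r s hr hrp hs hsp hqr hqs
  have hr1 := hqr.one_mod (n := 1) (by simpa using h)
  have hs1 := hqs.one_mod (n := 1) (by simpa using h)
  obtain ⟨k, hk, hrk, hrk'⟩ := exists_level hp hr.two_le hr1
  obtain ⟨l, hl, hsl, hsl'⟩ := exists_level hp hs.two_le hs1
  have hpk : ∀ k, 1 ≤ k → 3 ≤ p ^ k := fun k hk =>
    hp3.trans (Nat.le_self_pow (by omega) p)
  rcases le_total k l with hkl | hkl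
  · left
    rw [cl_exact hp (hpk k hk) hrk hrk']
    exact hsl.of_dvd (pow_dvd_pow _ hkl)
  · right
    rw [cl_exact hp (hpk l hl) hsl hsl']
    exact hrk.of_dvd (pow_dvd_pow _ hkl)

theorem exists_prime_modEq_pow {p q : ℕ} (hp : p.Prime) (hq : q.Prime) (hqp : q ≠ p) (a m : ℕ) :
    ∃ r : ℕ, r.Prime ∧ r ≠ p ∧ r ≡ q ^ a [MOD p ^ m] := by
  have hco : Nat.Coprime (q ^ a) (p ^ m) :=
    Nat.Coprime.pow _ _ ((Nat.coprime_primes hq hp).2 hqp)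
  obtain ⟨r, hrp, hr, hmod⟩ := Nat.forall_exists_prime_gt_and_modEq p (q := p ^ m)
    (a := q ^ a) (pow_pos hp.pos _).ne' hco
  exact ⟨r, hr, by omega, hmod⟩

theorem fermat_mod {p q : ℕ} (hp : p.Prime) (hq : q.Prime) (hqp : q ≠ p) :
    q ^ (p - 1) ≡ 1 [MOD p] := by
  have := Nat.ModEq.pow_totient ((Nat.coprime_primes hq hp).2 hqp)
  rwa [Nat.totient_prime hp] at this

theorem one_of_chain {p : ℕ} (hp : p.Prime) (hp2 : p ≠ 2) {q : ℕ} (hq : q.Prime) (hqp : q ≠ p)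
    (h : Chain p q) : q ≡ 1 [MOD p] := by
  have hp3 : 3 ≤ p := by have := hp.two_le; omega
  by_contra hq1
  have hf := fermat_mod hp hq hqp
  have hge : 2 ≤ q ^ (p - 1) := hq.two_le.trans (Nat.le_self_pow (by omega) q)
  obtain ⟨k, hk, hk1, hk2⟩ := exists_level hp (n := 1) hge (by simpa using hf)
  have hpk : 3 ≤ p ^ k := hp3.trans (Nat.le_self_pow (by omega) p)
  obtain ⟨r, hr, hrp, hrm⟩ := exists_prime_modEq_pow hp hq hqp (p - 1) (k + 1)
  obtain ⟨s, hs, hsp, hsm⟩ := exists_prime_modEq_pow hp hq hqp p (k + 1)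
  have hqr : Cl p q r := cl_of_modEq hp hpk (e := p - 1) (j := p - 1) (by omega) hk1 hk2
    (hrm.of_dvd (pow_dvd_pow _ (by omega))).symm
  have hqs : Cl p q s := cl_of_modEq hp hpk (e := p - 1) (j := p) (by omega) hk1 hk2
    (hsm.of_dvd (pow_dvd_pow _ (by omega))).symm
  have hdk : p ∣ p ^ (k + 1) := dvd_pow_self _ (by omega)
  rcases h r s hr hrp hs hsp hqr hqs with h | h
  · -- `s` would be `1` mod `p`
    have hr1 : r ≡ 1 [MOD p ^ 1] := by
      rw [pow_one]; exact (hrm.of_dvd hdk).trans hf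
    have hs1 := h.one_mod hr1
    rw [pow_one] at hs1
    apply hq1
    have e1 : q ^ p ≡ 1 [MOD p] := (hsm.of_dvd hdk).symm.trans hs1
    have e2 : q ^ p = q ^ (p - 1) * q := by rw [← pow_succ]; congr 1; omega
    rw [e2] at e1
    have e3 := hf.mul_right q
    rw [one_mul] at e3
    exact e3.symm.trans e1
  · obtain ⟨i, hi, hi2⟩ := h (k + 1)
    -- `q ^ (p - 1) ≡ q ^ (p * i)`
    have e1 : q ^ (p - 1) ≡ (q ^ p) ^ i [MOD p ^ (k + 1)] :=
      hrm.symm.trans (hi2.symm.trans (hsm.pow i))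
    have e2 := e1.pow (p - 1)
    -- right hand side is one
    have e3 : (q ^ (p - 1)) ^ p ≡ 1 [MOD p ^ (k + 1)] := pow_prime_level hp hpk hk1
    have e4 : ((q ^ p) ^ i) ^ (p - 1) ≡ 1 [MOD p ^ (k + 1)] := by
      have : ((q ^ p) ^ i) ^ (p - 1) = ((q ^ (p - 1)) ^ p) ^ i := by
        rw [← pow_mul, ← pow_mul, ← pow_mul, ← pow_mul]; congr 1; ring
      rw [this]
      simpa using e3.pow i
    have e5 : (q ^ (p - 1)) ^ (p - 1) ≡ 1 [MOD p ^ (k + 1)] := e2.trans e4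
    -- together with `e3` get contradiction
    apply hk2
    have e6 : (q ^ (p - 1)) ^ p = (q ^ (p - 1)) ^ (p - 1) * q ^ (p - 1) := by
      rw [← pow_succ]; congr 1; omega
    rw [e6] at e3
    have e7 := e5.mul_right (q ^ (p - 1))
    rw [one_mul] at e7
    exact e7.symm.trans e3

/-- Existence of a topological generator for odd primes. -/
theorem odd_generator {p : ℕ} (hp : p.Prime) (hp2 : p ≠ 2) :
    ∃ s : ℕ, s.Prime ∧ s ≠ p ∧ ∀ q : ℕ, q.Prime → q ≠ p → Cl p s q := by
  have hp3 : 3 ≤ p := by have := hp.two_le; omega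
  have hcyc := ZMod.isCyclic_units_of_prime_pow p hp hp2 2
  obtain ⟨g, hg⟩ := hcyc.exists_generator
  have : NeZero (p ^ 2) := ⟨(pow_pos hp.pos _).ne'⟩
  obtain ⟨s, hsp, hs, hsg⟩ := Nat.forall_exists_prime_gt_and_eq_mod (q := p ^ 2)
    (a := (g : ZMod (p ^ 2))) g.isUnit p
  have hsp' : s ≠ p := by omega
  refine ⟨s, hs, hsp', fun q hq hqp => ?_⟩
  have hcoq : Nat.Coprime q (p ^ 2) := Nat.Coprime.pow_right _ ((Nat.coprime_primes hq hp).2 hqp)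
  obtain ⟨j, hj⟩ : ∃ j : ℕ, g ^ j = ZMod.unitOfCoprime q hcoq := by
    have := hg (ZMod.unitOfCoprime q hcoq)
    rw [← mem_powers_iff_mem_zpowers] at this
    obtain ⟨j, hj⟩ := this
    exact ⟨j, hj⟩
  have hjm : s ^ j ≡ q [MOD p ^ 2] := by
    rw [← ZMod.natCast_eq_natCast_iff]
    push_cast
    rw [hsg, ← Units.val_pow_eq_pow_val, hj]
    simp
  refine cl_of_modEq hp (n := 1) (e := p - 1) (j := j) (by simpa using hp3) (by omega)
    (by simpa using fermat_mod hp hs hsp') ?_ (hjm.of_dvd (pow_dvd_pow _ (by omega)))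
  intro h
  rw [← ZMod.natCast_eq_natCast_iff] at h
  push_cast at h
  have h2 : g ^ (p - 1) = 1 := by
    ext
    rw [Units.val_pow_eq_pow_val, ← hsg]
    simpa using h
  have h3 : orderOf g = Nat.card (ZMod (p ^ 2))ˣ := orderOf_eq_card_of_forall_mem_zpowers hg
  rw [Nat.card_eq_fintype_card, ZMod.card_units_eq_totient,
    Nat.totient_prime_pow hp (by norm_num)] at h3
  have h4 := Nat.le_of_dvd (by omega) (orderOf_dvd_of_pow_eq_one h2)
  rw [h3] at h4
  simp only [Nat.add_one_sub_one, pow_one] at h4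
  have : 0 < p - 1 := by omega
  nlinarith

theorem two_no_generator (s : ℕ) (h3 : Cl 2 s 3) (h5 : Cl 2 s 5) : False := by
  obtain ⟨i, hi, h3⟩ := h3 3
  obtain ⟨j, hj, h5⟩ := h5 3
  have key : ∀ n : ℕ, s ^ n % 8 = 1 ∨ s ^ n % 8 = s % 8 ∨ s % 2 = 0 := by
    intro n
    induction n with
    | zero => left; rfl
    | succ n ih =>
      rw [pow_succ, Nat.mul_mod]
      have : s % 8 < 8 := Nat.mod_lt _ (by norm_num)
      rcases ih with h | h | h
      · rw [h]; omega
      · rw [h]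
        by_cases h0 : s % 2 = 0
        · omega
        · left
          have : s % 8 = 1 ∨ s % 8 = 3 ∨ s % 8 = 5 ∨ s % 8 = 7 := by omega
          rcases this with h | h | h | h <;> rw [h]
      · omega
  have hs2 : s % 2 ≠ 0 := by
    intro h0
    have : s ^ i % 2 = 0 := by
      have : 2 ∣ s ^ i := dvd_pow (Nat.dvd_of_mod_eq_zero h0) (by omega)
      omega
    simp only [Nat.ModEq] at h3
    omega
  have k1 := key i
  have k2 := key j
  simp only [Nat.ModEq] at h3 h5
  norm_num at h3 h5
  omega

/-- Level step. -/
theorem level_step {p : ℕ} (hp : p.Prime) {n : ℕ} (hn : 3 ≤ p ^ n) {q : ℕ} :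
    q ≡ 1 [MOD p ^ (n + 1)] ↔ q ≡ 1 [MOD p ^ n] ∧ ∃ r : ℕ, r.Prime ∧ r ≠ p ∧
      r ≡ 1 [MOD p ^ n] ∧ Cl p r q ∧ ¬ Cl p q r := by
  have hn0 : 1 ≤ n := by
    rcases Nat.eq_zero_or_pos n with rfl | h
    · simp at hn
    · exact h
  constructor
  · intro h
    have h' := h.of_dvd (pow_dvd_pow p (Nat.le_succ n))
    obtain ⟨r, hr, hrp, hr1, hr2⟩ := exists_exact hp hn0
    exact ⟨h', r, hr, hrp, hr1, (cl_exact hp hn hr1 hr2 q).2 h', fun hc => hr2 (hc.one_mod h)⟩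
  · rintro ⟨h1, r, hr, hrp, hr1, -, hnc⟩
    by_contra h2
    exact hnc ((cl_exact hp hn h1 h2 r).2 hr1)

theorem odd_sq_mod8 {q : ℕ} (hq : q % 2 = 1) : q ^ 2 ≡ 1 [MOD 8] := by
  have : q % 8 = 1 ∨ q % 8 = 3 ∨ q % 8 = 5 ∨ q % 8 = 7 := by omega
  rw [Nat.ModEq, Nat.pow_mod]
  rcases this with h | h | h | h <;> rw [h]

theorem level_eight {q : ℕ} (hq : q.Prime) (hq2 : q ≠ 2) :
    q ≡ 1 [MOD 2 ^ 3] ↔ ∃ r : ℕ, r.Prime ∧ r ≠ 2 ∧ Cl 2 r q ∧ ¬ Cl 2 q r := by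
  constructor
  · intro h
    refine ⟨5, by norm_num, by norm_num, ?_, ?_⟩
    · rw [cl_exact Nat.prime_two (n := 2) (by norm_num) (by decide) (by decide)]
      exact h.of_dvd (by norm_num)
    · intro hc
      have := hc.one_mod h
      exact absurd this (by decide)
  · rintro ⟨r, hr, hr2, hrq, hnc⟩
    by_contra h8
    apply hnc
    have hqo : q % 2 = 1 := hq.eq_two_or_odd.resolve_left hq2
    have hro : r % 2 = 1 := hr.eq_two_or_odd.resolve_left hr2
    -- level of `q ^ 2`
    obtain ⟨k, hk, hk1, hk2⟩ := exists_level Nat.prime_two (x := q ^ 2) (n := 3)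
      (by have := hq.two_le; nlinarith) (odd_sq_mod8 hqo)
    obtain ⟨l, hl, hl1, hl2⟩ := exists_level Nat.prime_two (x := r ^ 2) (n := 3)
      (by have := hr.two_le; nlinarith) (odd_sq_mod8 hro)
    have h3 : ∀ k, 3 ≤ k → 3 ≤ 2 ^ k := fun k hk =>
      (by norm_num : 3 ≤ 2 ^ 3).trans (Nat.pow_le_pow_right (by norm_num) hk)
    obtain ⟨i, hi, him⟩ := hrq (k + l + 3)
    -- `i` is odd
    have hiodd : ∃ a, i = 2 * a + 1 := by
      rcases Nat.even_or_odd' i with ⟨a, rfl | rfl⟩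
      · exfalso
        apply h8
        have e1 := him.of_dvd (pow_dvd_pow 2 (by omega : 3 ≤ k + l + 3))
        have e2 := (odd_sq_mod8 hro).pow a
        rw [one_pow, ← pow_mul] at e2
        exact e1.symm.trans e2
      · exact ⟨a, rfl⟩
    obtain ⟨a, rfl⟩ := hiodd
    -- `q ≡ r` modulo `2 ^ l`
    have e1 : q ≡ r [MOD 2 ^ l] := by
      have e1 := him.of_dvd (pow_dvd_pow 2 (by omega : l ≤ k + l + 3))
      have e2 := (hl1.pow a).mul_right r
      rw [one_pow, ← pow_mul, ← pow_succ, one_mul] at e2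
      exact e1.symm.trans e2
    -- `k ≤ l`
    have hkl : k ≤ l := by
      by_contra hlt
      push Not at hlt
      -- then `q ^ 2 ≡ 1` modulo `2 ^ (l + 1)`, hence `r ^ 2` too
      apply hl2
      have f1 : (r ^ 2) ^ (2 * a + 1) ≡ 1 [MOD 2 ^ (l + 1)] := by
        have f1 := (him.of_dvd (pow_dvd_pow 2 (by omega : l + 1 ≤ k + l + 3))).pow 2
        have f2 := hk1.of_dvd (pow_dvd_pow 2 (by omega : l + 1 ≤ k))
        rw [← pow_mul, mul_comm, pow_mul] at f1
        exact f1.trans f2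
      -- `r ^ 4 ≡ 1` modulo `2 ^ (l + 1)`
      have f3 : (r ^ 2) ^ 2 ≡ 1 [MOD 2 ^ (l + 1)] := pow_prime_level Nat.prime_two (h3 l hl) hl1
      have f4 := (f3.pow a).mul_right (r ^ 2)
      rw [one_pow, ← pow_mul, ← pow_succ, one_mul] at f4
      exact f4.symm.trans f1
    exact cl_of_modEq Nat.prime_two (h3 k hk) (e := 2) (j := 1) (by norm_num) hk1 hk2
      (by rw [pow_one]; exact e1.of_dvd (pow_dvd_pow _ hkl))

/-! ### The induced permutation of primes -/

theorem toP {p : ℕ} (hp : p.Prime) : ((p.toPNat' : ℕ+) : ℕ) = p := by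
  rw [Nat.toPNat'_coe, if_pos hp.pos]

/-- The permutation of primes induced by a homeomorphism. -/
def sg (h : ℕ+ ≃ₜ ℕ+) (p : ℕ) : ℕ := Nat.minFac (h p.toPNat' : ℕ+)

theorem homeo_coprime_iff (h : ℕ+ ≃ₜ ℕ+) (x y : ℕ+) :
    Nat.Coprime (h x) (h y) ↔ Nat.Coprime x y := by
  refine ⟨fun H => ?_, homeo_coprime h⟩
  simpa using homeo_coprime h.symm H

theorem homeo_eq_one (h : ℕ+ ≃ₜ ℕ+) {x : ℕ+} (hx : (h x : ℕ) = 1) : x = 1 := by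
  apply h.injective
  rw [homeo_one]
  exact PNat.coe_injective hx

theorem sg_prime (h : ℕ+ ≃ₜ ℕ+) {p : ℕ} (hp : p.Prime) : (sg h p).Prime := by
  apply Nat.minFac_prime
  intro h1
  have := congrArg PNat.val (homeo_eq_one h h1)
  have h2 := toP hp
  have := hp.one_lt
  simp_all

theorem sg_unique (h : ℕ+ ≃ₜ ℕ+) {p : ℕ} (hp : p.Prime) {x : ℕ+}
    (hx : ∀ r : ℕ, r.Prime → r ∣ x → r = p) (r : ℕ) (hr : r.Prime) (hrx : r ∣ h x) :
    r = sg h p := by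
  by_contra hne
  have hs := sg_prime h hp
  have hco : Nat.Coprime r (sg h p) := (Nat.coprime_primes hr hs).2 hne
  have hco2 : Nat.Coprime (h (h.symm r.toPNat')) (h (h.symm (sg h p).toPNat')) := by
    simpa only [Homeomorph.apply_symm_apply, toP hr, toP hs] using hco
  rw [homeo_coprime_iff] at hco2
  have h1 : p ∣ h.symm r.toPNat' := by
    have : ¬ Nat.Coprime x (h.symm r.toPNat') := by
      rw [← homeo_coprime_iff h, Homeomorph.apply_symm_apply, toP hr, Nat.coprime_comm,
        Nat.Prime.coprime_iff_not_dvd hr]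
      exact not_not.2 hrx
    obtain ⟨l, hl, hlx, hly⟩ := Nat.Prime.not_coprime_iff_dvd.1 this
    rwa [hx l hl hlx] at hly
  have h2 : p ∣ h.symm (sg h p).toPNat' := by
    have : ¬ Nat.Coprime (p.toPNat' : ℕ+) (h.symm (sg h p).toPNat') := by
      rw [← homeo_coprime_iff h, Homeomorph.apply_symm_apply, toP hs, Nat.coprime_comm,
        Nat.Prime.coprime_iff_not_dvd hs]
      exact not_not.2 (Nat.minFac_dvd _)
    rw [toP hp, Nat.Prime.coprime_iff_not_dvd hp, not_not] at this
    exact this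
  exact hp.one_lt.ne' (Nat.dvd_one.1 (hco2 ▸ Nat.dvd_gcd h1 h2))

theorem prime_toP {p : ℕ} (hp : p.Prime) (r : ℕ) (hr : r.Prime) (h : r ∣ (p.toPNat' : ℕ+)) :
    r = p := by
  rw [toP hp] at h
  exact (Nat.prime_dvd_prime_iff_eq hr hp).1 h

theorem sg_dvd (h : ℕ+ ≃ₜ ℕ+) {p : ℕ} (hp : p.Prime) {x : ℕ+} (hx : p ∣ x) : sg h p ∣ h x := by
  have h1 : ¬ Nat.Coprime (p.toPNat' : ℕ+) x := by
    rw [toP hp, Nat.Prime.coprime_iff_not_dvd hp, not_not]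
    exact hx
  rw [← homeo_coprime_iff h] at h1
  obtain ⟨l, hl, hlx, hly⟩ := Nat.Prime.not_coprime_iff_dvd.1 h1
  rwa [← sg_unique h hp (prime_toP hp) l hl hlx]

theorem sg_symm (h : ℕ+ ≃ₜ ℕ+) {p : ℕ} (hp : p.Prime) : sg h.symm (sg h p) = p := by
  have := sg_unique h.symm (sg_prime h hp) (x := h p.toPNat')
    (sg_unique h hp (prime_toP hp)) p hp (by simp [toP hp])
  exact this.symm

theorem sg_symm' (h : ℕ+ ≃ₜ ℕ+) {p : ℕ} (hp : p.Prime) : sg h (sg h.symm p) = p :=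
  sg_symm h.symm hp

theorem sg_ne (h : ℕ+ ≃ₜ ℕ+) {p q : ℕ} (hp : p.Prime) (hq : q.Prime) (hpq : p ≠ q) :
    sg h p ≠ sg h q := by
  intro H
  apply hpq
  rw [← sg_symm h hp, H, sg_symm h hq]

theorem sg_dvd_iff (h : ℕ+ ≃ₜ ℕ+) {p : ℕ} (hp : p.Prime) {x : ℕ+} : sg h p ∣ h x ↔ p ∣ x := by
  refine ⟨fun H => ?_, sg_dvd h hp⟩
  simpa [sg_symm h hp] using sg_dvd h.symm (sg_prime h hp) H

theorem homeo_pow (h : ℕ+ ≃ₜ ℕ+) {p : ℕ} (hp : p.Prime) {x : ℕ+} {n : ℕ} (hn : 1 ≤ n)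
    (hx : (x : ℕ) = p ^ n) : ∃ m, 1 ≤ m ∧ (h x : ℕ) = sg h p ^ m := by
  have h1 := sg_unique h hp (x := x) (by
    intro r hr hrx
    rw [hx] at hrx
    exact (Nat.prime_dvd_prime_iff_eq hr hp).1 (hr.dvd_of_dvd_pow hrx))
  have h2 := Nat.eq_prime_pow_of_unique_prime_dvd (n := (h x : ℕ+)) (p := sg h p) (h x).ne_zero
    (fun {d} hd hdx => h1 d hd hdx)
  refine ⟨_, ?_, h2⟩
  rcases Nat.eq_zero_or_pos ((h x : ℕ).primeFactorsList.length) with h0 | h0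
  · rw [h0, pow_zero] at h2
    have h3 := homeo_eq_one h h2
    subst h3
    have h4 : p ∣ 1 := by
      have : (1 : ℕ) = p ^ n := by simpa using hx
      rw [this]
      exact dvd_pow_self _ (by omega)
    exact absurd (Nat.dvd_one.1 h4) hp.ne_one
  · exact h0

theorem Cl.not_dvd {p q x : ℕ} (hp : p.Prime) (hq : q.Prime) (hpq : p ≠ q) (H : Cl p q x) :
    ¬ p ∣ x := by
  intro hpx
  obtain ⟨i, hi, h⟩ := H 1
  rw [pow_one] at h
  have h1 : p ∣ q ^ i := (h.dvd_iff dvd_rfl).2 hpx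
  exact hpq ((Nat.prime_dvd_prime_iff_eq hp hq).1 (hp.dvd_of_dvd_pow h1))

theorem Cl.homeo (h : ℕ+ ≃ₜ ℕ+) {p q : ℕ} (hp : p.Prime) (hq : q.Prime) (hpq : p ≠ q) {x : ℕ+}
    (H : Cl p q x) : Cl (sg h p) (sg h q) (h x) := by
  have hpx := H.not_dvd hp hq hpq
  set A : Set ℕ+ := {a | ∃ i : ℕ, 1 ≤ i ∧ (a : ℕ) = q ^ i} with hA
  set B : Set ℕ+ := {a | ∃ i : ℕ, 1 ≤ i ∧ (a : ℕ) = sg h q ^ i} with hB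
  have npow : ∀ {p q : ℕ}, p.Prime → q.Prime → p ≠ q → ∀ i, ¬ p ∣ q ^ i := by
    intro p q hp hq hpq i hd
    exact hpq ((Nat.prime_dvd_prime_iff_eq hp hq).1 (hp.dvd_of_dvd_pow hd))
  have hAp : ∀ a ∈ A, ¬ p ∣ a := by
    rintro a ⟨i, hi, ha⟩
    rw [ha]; exact npow hp hq hpq i
  have hBp : ∀ a ∈ B, ¬ sg h p ∣ a := by
    rintro a ⟨i, hi, ha⟩
    rw [ha]; exact npow (sg_prime h hp) (sg_prime h hq) (sg_ne h hp hq hpq) i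
  set u : ℕ+ := p.toPNat' with hu
  have hup : (u : ℕ) = p := toP hp
  have huv : u ≠ u * u := by
    intro h1
    have := congrArg PNat.val h1
    have h2 : (u : ℕ) = u * u := by rw [← PNat.mul_coe]; exact this
    rw [hup] at h2
    have := hp.one_lt
    nlinarith
  have key := padic_to_top hp (x := x) huv (fun r hr hd => prime_toP hp r hr hd)
    (fun r hr hd => by
      rw [PNat.mul_coe] at hd
      rcases hr.dvd_mul.1 hd with hd | hd <;> exact prime_toP hp r hr hd)
    (by rw [hup]) (by rw [PNat.mul_coe, hup]; exact dvd_mul_right p p) A hAp (by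
      intro k
      obtain ⟨i, hi, h1⟩ := H k
      exact ⟨⟨q ^ i, pow_pos hq.pos i⟩, ⟨i, hi, rfl⟩, h1⟩)
  have key2 := top_to_padic (sg_prime h hp) (x := h x) (u := h u) (v := h (u * u))
    (by rw [sg_dvd_iff h hp]; exact hpx)
    (sg_dvd h hp (by rw [hup])) (sg_dvd h hp (by rw [PNat.mul_coe, hup]; exact dvd_mul_right p p))
    B hBp (by
      intro V hV
      have h1 := hV.image h.symm
      simp only [Homeomorph.symm_apply_apply] at h1
      obtain ⟨a, ⟨i, hi, ha⟩, h2⟩ := key _ h1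
      refine ⟨h a, homeo_pow h hq hi ha, (h2.image h).mono ?_⟩
      rintro _ ⟨_, ⟨y, hy, rfl⟩, rfl⟩
      simpa using hy)
  intro m
  obtain ⟨b, ⟨i, hi, hb⟩, h1⟩ := key2 m
  exact ⟨i, hi, hb ▸ h1⟩

theorem cl_sg (h : ℕ+ ≃ₜ ℕ+) {p q r : ℕ} (hp : p.Prime) (hq : q.Prime) (hr : r.Prime)
    (hpr : p ≠ r) (H : Cl p r q) : Cl (sg h p) (sg h r) (sg h q) := by
  have hs := sg_prime h hq
  obtain ⟨j, hj, h1⟩ := homeo_pow h.symm hs (x := (sg h q).toPNat') le_rfl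
    (by rw [toP hs, pow_one])
  rw [sg_symm h hq] at h1
  have h2 := H.pow j hj
  rw [← h1] at h2
  have h3 := h2.homeo h hp hr hpr
  rwa [Homeomorph.apply_symm_apply, toP hs] at h3

theorem cl_sg_iff (h : ℕ+ ≃ₜ ℕ+) {p q r : ℕ} (hp : p.Prime) (hq : q.Prime) (hr : r.Prime)
    (hpr : p ≠ r) : Cl (sg h p) (sg h r) (sg h q) ↔ Cl p r q := by
  refine ⟨fun H => ?_, cl_sg h hp hq hr hpr⟩
  have := cl_sg h.symm (sg_prime h hp) (sg_prime h hq) (sg_prime h hr) (sg_ne h hp hr hpr) H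
  rwa [sg_symm h hp, sg_symm h hq, sg_symm h hr] at this

theorem eq_two_of_sg (h : ℕ+ ≃ₜ ℕ+) {p : ℕ} (hp : p.Prime) (h2 : sg h p = 2) : p = 2 := by
  by_contra hp2
  obtain ⟨s, hs, hsp, H⟩ := odd_generator hp hp2
  have aux : ∀ q : ℕ, q.Prime → q ≠ 2 → Cl 2 (sg h s) q := by
    intro q hq hq2
    have hq' := sg_prime h.symm hq
    have h3 := H (sg h.symm q) hq' (by
      rintro h4
      apply hq2
      rw [← sg_symm' h hq, h4, h2])
    have := cl_sg h hp hq' hs hsp.symm h3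
    rwa [h2, sg_symm' h hq] at this
  exact two_no_generator _ (aux 3 (by norm_num) (by norm_num)) (aux 5 (by norm_num) (by norm_num))

theorem sg_two (h : ℕ+ ≃ₜ ℕ+) : sg h 2 = 2 := by
  have h1 := sg_symm' h Nat.prime_two
  have h2 := eq_two_of_sg h (sg_prime h.symm Nat.prime_two) h1
  rwa [h2] at h1

theorem chain_sg (h : ℕ+ ≃ₜ ℕ+) {p q : ℕ} (hp : p.Prime) (hq : q.Prime) (hpq : p ≠ q)
    (H : Chain p q) : Chain (sg h p) (sg h q) := by
  intro r s hr hrp hs hsp hqr hqs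
  have hr' := sg_prime h.symm hr
  have hs' := sg_prime h.symm hs
  rw [← sg_symm' h hr] at hqr hrp ⊢
  rw [← sg_symm' h hs] at hqs hsp ⊢
  have hrp' : sg h.symm r ≠ p := fun e => hrp (by rw [e])
  have hsp' : sg h.symm s ≠ p := fun e => hsp (by rw [e])
  rw [cl_sg_iff h hp hr' hq hpq] at hqr
  rw [cl_sg_iff h hp hs' hq hpq] at hqs
  rw [cl_sg_iff h hp hs' hr' hrp'.symm, cl_sg_iff h hp hr' hs' hsp'.symm]
  exact H _ _ hr' hrp' hs' hsp' hqr hqs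

theorem level_base_odd (h : ℕ+ ≃ₜ ℕ+) {p : ℕ} (hp : p.Prime) (hp2 : p ≠ 2) {q : ℕ}
    (hq : q.Prime) (hqp : q ≠ p) (H : q ≡ 1 [MOD p]) : sg h q ≡ 1 [MOD sg h p] :=
  one_of_chain (sg_prime h hp) (fun e => hp2 (eq_two_of_sg h hp e)) (sg_prime h hq)
    (sg_ne h hq hp hqp) (chain_sg h hp hq hqp.symm (chain_of_one hp hp2 H))

theorem level_base_two (h : ℕ+ ≃ₜ ℕ+) {q : ℕ}
    (hq : q.Prime) (hq2 : q ≠ 2) (H : q ≡ 1 [MOD 2 ^ 3]) : sg h q ≡ 1 [MOD 2 ^ 3] := by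
  rw [level_eight hq hq2] at H
  obtain ⟨r, hr, hr2, h1, h2⟩ := H
  have h2s := sg_two h
  have hp2 := Nat.prime_two
  rw [level_eight (sg_prime h hq) (fun e => hq2 (eq_two_of_sg h hq e))]
  refine ⟨sg h r, sg_prime h hr, fun e => hr2 (eq_two_of_sg h hr e), ?_, ?_⟩
  · have := (cl_sg_iff h hp2 hq hr hr2.symm).2 h1
    rwa [h2s] at this
  · intro h3
    apply h2
    rw [← cl_sg_iff h hp2 hr hq hq2.symm, h2s]
    exact h3

theorem three_le_pow {p : ℕ} (hp : p.Prime) {n : ℕ} (hn : 1 ≤ n) (hpn : p = 2 → 2 ≤ n) :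
    3 ≤ p ^ n := by
  have h2 := hp.two_le
  by_cases hp2 : p = 2
  · subst hp2
    exact (by norm_num : 3 ≤ 2 ^ 2).trans (Nat.pow_le_pow_right (by norm_num) (hpn rfl))
  · exact (by omega : 3 ≤ p).trans (Nat.le_self_pow (by omega) p)

theorem level_succ (h : ℕ+ ≃ₜ ℕ+) {p : ℕ} (hp : p.Prime) {n : ℕ} (hn : 1 ≤ n)
    (hpn : p = 2 → 2 ≤ n)
    (ih : ∀ q : ℕ, q.Prime → q ≠ p → q ≡ 1 [MOD p ^ n] → sg h q ≡ 1 [MOD sg h p ^ n])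
    {q : ℕ} (hq : q.Prime) (hqp : q ≠ p) (H : q ≡ 1 [MOD p ^ (n + 1)]) :
    sg h q ≡ 1 [MOD sg h p ^ (n + 1)] := by
  have hsp := sg_prime h hp
  rw [level_step hp (three_le_pow hp hn hpn)] at H
  obtain ⟨h1, r, hr, hrp, hr1, h2, h3⟩ := H
  rw [level_step hsp (three_le_pow hsp hn (fun e => hpn (eq_two_of_sg h hp e)))]
  refine ⟨ih q hq hqp h1, sg h r, sg_prime h hr, sg_ne h hr hp hrp, ih r hr hrp hr1, ?_, ?_⟩
  · rwa [cl_sg_iff h hp hq hr hrp.symm]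
  · rwa [cl_sg_iff h hp hr hq hqp.symm]

theorem level_prime (h : ℕ+ ≃ₜ ℕ+) {p : ℕ} (hp : p.Prime) (n : ℕ) (hn : 1 ≤ n)
    (hpn : p = 2 → 3 ≤ n) :
    ∀ q : ℕ, q.Prime → q ≠ p → q ≡ 1 [MOD p ^ n] → sg h q ≡ 1 [MOD sg h p ^ n] := by
  by_cases hp2 : p = 2
  · subst hp2
    have h3 := hpn rfl
    clear hpn hn
    induction n, h3 using Nat.le_induction with
    | base =>
      intro q hq hqp H
      rw [sg_two]
      exact level_base_two h hq hqp H
    | succ n h3 ih =>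
      intro q hq hqp H
      exact level_succ h hp (by omega) (fun _ => by omega) ih hq hqp H
  · clear hpn
    induction n, hn using Nat.le_induction with
    | base =>
      intro q hq hqp H
      rw [pow_one] at H ⊢
      exact level_base_odd h hp hp2 hq hqp H
    | succ n hn ih =>
      intro q hq hqp H
      exact level_succ h hp hn (fun e => absurd e hp2) ih hq hqp H

theorem level_all (h : ℕ+ ≃ₜ ℕ+) {p : ℕ} (hp : p.Prime) {n : ℕ} (hn : 1 ≤ n)
    (hpn : p = 2 → 3 ≤ n) {x : ℕ+} (hx : (x : ℕ) ≡ 1 [MOD p ^ n]) :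
    (h x : ℕ) ≡ 1 [MOD sg h p ^ n] := by
  obtain ⟨q, hq, hqp, hq1, hq2⟩ := exists_exact hp hn
  have h1 := (cl_exact hp (three_le_pow hp hn (fun e => by have := hpn e; omega)) hq1 hq2 x).2 hx
  exact (h1.homeo h hp hq hqp.symm).one_mod (level_prime h hp n hn hpn q hq hqp hq1)

theorem level_all_symm (h : ℕ+ ≃ₜ ℕ+) {p : ℕ} (hp : p.Prime) {n : ℕ} (hn : 1 ≤ n)
    (hpn : p = 2 → 3 ≤ n) {x : ℕ+} (hx : (h x : ℕ) ≡ 1 [MOD p ^ n]) :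
    (x : ℕ) ≡ 1 [MOD sg h.symm p ^ n] := by
  simpa using level_all h.symm hp hn hpn hx

/-! ### Small values -/

theorem small_values (h : ℕ+ ≃ₜ ℕ+) {x : ℕ+} (hx1 : x ≠ 1)
    (hx : ∀ p : ℕ, p.Prime → p ≠ 2 → ¬ (x : ℕ) ≡ 1 [MOD p]) : ∃ m, (h x : ℕ) = 2 ^ m + 1 := by
  have hpos := (h x).pos
  have hne : (h x : ℕ) ≠ 1 := fun e => hx1 (homeo_eq_one h e)
  have h2 := Nat.eq_prime_pow_of_unique_prime_dvd (n := (h x : ℕ) - 1) (p := 2) (by omega) (by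
    intro d hd hdx
    by_contra hd2
    have h1 : (h x : ℕ) ≡ 1 [MOD d ^ 1] := by
      rw [pow_one]
      exact ((Nat.modEq_iff_dvd' (by omega)).2 hdx).symm
    have h3 := level_all_symm h hd le_rfl (fun e => absurd e hd2) h1
    rw [pow_one] at h3
    exact hx _ (sg_prime h.symm hd) (fun e => hd2 (eq_two_of_sg h.symm hd e)) h3)
  exact ⟨((h x : ℕ) - 1).primeFactorsList.length, by omega⟩

theorem no_odd {N : ℕ} (k : ℕ) (hN : N = 2 ^ k + 1) (p : ℕ) (hp : p.Prime) (hp2 : p ≠ 2) :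
    ¬ N ≡ 1 [MOD p] := by
  intro h
  have h0 : 1 ≤ N := by rw [hN]; exact Nat.le_add_left 1 _
  have h1 := (Nat.modEq_iff_dvd' h0).1 h.symm
  rw [hN, Nat.add_sub_cancel] at h1
  exact hp2 ((Nat.prime_dvd_prime_iff_eq hp Nat.prime_two).1 (hp.dvd_of_dvd_pow h1))

theorem two_pow_add_one_mod {m n : ℕ} : 2 ^ m + 1 ≡ 1 [MOD 2 ^ n] ↔ n ≤ m := by
  constructor
  · intro h
    have h1 := (Nat.modEq_iff_dvd' (Nat.le_add_left 1 (2 ^ m))).1 h.symm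
    rw [Nat.add_sub_cancel] at h1
    exact (Nat.pow_dvd_pow_iff_le_right (by norm_num)).1 h1
  · intro h
    apply Nat.ModEq.symm
    rw [Nat.modEq_iff_dvd' (Nat.le_add_left 1 (2 ^ m)), Nat.add_sub_cancel]
    exact pow_dvd_pow _ h

theorem homeo_small_lt (h : ℕ+ ≃ₜ ℕ+) {x : ℕ+} (k : ℕ) (hk : (x : ℕ) = 2 ^ k + 1) :
    ∃ m, (h x : ℕ) = 2 ^ m + 1 ∧ ∀ n, 3 ≤ n → (n ≤ m ↔ n ≤ k) := by
  have hx1 : x ≠ 1 := by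
    rintro rfl
    have : 0 < 2 ^ k := by positivity
    simp at hk
  obtain ⟨m, hm⟩ := small_values h hx1 (no_odd k hk)
  refine ⟨m, hm, fun n hn => ⟨fun hnm => ?_, fun hnk => ?_⟩⟩
  · rw [← two_pow_add_one_mod, ← hm] at hnm
    have := level_all_symm h Nat.prime_two (by omega) (fun _ => hn) hnm
    rwa [sg_two, hk, two_pow_add_one_mod] at this
  · rw [← two_pow_add_one_mod, ← hk] at hnk
    have := level_all h Nat.prime_two (by omega) (fun _ => hn) hnk
    rwa [sg_two, hm, two_pow_add_one_mod] at this

theorem homeo_two (h : ℕ+ ≃ₜ ℕ+) : h 2 = 2 := by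
  obtain ⟨m, hm, -⟩ := homeo_small_lt h (x := 2) 0 rfl
  have h1 := sg_dvd h Nat.prime_two (x := 2) (by norm_num)
  rw [sg_two, hm] at h1
  apply PNat.coe_injective
  rw [hm]
  rcases Nat.eq_zero_or_pos m with rfl | h0
  · rfl
  · have := (Nat.dvd_add_right (dvd_pow_self 2 h0.ne')).1 h1
    omega

theorem sg_three (h : ℕ+ ≃ₜ ℕ+) : sg h 3 = 3 := by
  obtain ⟨m, hm, hmk⟩ := homeo_small_lt h (x := 9) 3 rfl
  have h1 := (hmk 3 le_rfl).2 le_rfl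
  have h2 := (hmk 4 (by norm_num))
  have h3 : m = 3 := by omega
  subst h3
  have h4 := sg_dvd h Nat.prime_three (x := 9) (by decide)
  rw [hm] at h4
  have h5 : sg h 3 ∣ 3 ^ 2 := by simpa using h4
  exact (Nat.prime_dvd_prime_iff_eq (sg_prime h Nat.prime_three) Nat.prime_three).1
    ((sg_prime h Nat.prime_three).dvd_of_dvd_pow h5)

theorem homeo_three (h : ℕ+ ≃ₜ ℕ+) : h 3 = 3 := by
  obtain ⟨m, hm, hmk⟩ := homeo_small_lt h (x := 3) 1 rfl
  have h2 := hmk 3 le_rfl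
  have h4 := sg_dvd h Nat.prime_three (x := 3) (by decide)
  rw [sg_three, hm] at h4
  have h5 : m < 3 := by omega
  apply PNat.coe_injective
  rw [hm]
  interval_cases m <;> revert h4 <;> decide

theorem homeo_five (h : ℕ+ ≃ₜ ℕ+) : h 5 = 5 := by
  obtain ⟨m, hm, hmk⟩ := homeo_small_lt h (x := 5) 2 rfl
  have h2 := hmk 3 le_rfl
  have h5 : m < 3 := by omega
  have n2 : (h 5 : ℕ) ≠ 2 := by
    intro e
    have e1 : h 5 = h 2 := by rw [homeo_two]; exact PNat.coe_injective e
    exact absurd (h.injective e1) (by decide)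
  have n3 : (h 5 : ℕ) ≠ 3 := by
    intro e
    have e1 : h 5 = h 3 := by rw [homeo_three]; exact PNat.coe_injective e
    exact absurd (h.injective e1) (by decide)
  apply PNat.coe_injective
  rw [hm] at n2 n3 ⊢
  interval_cases m <;> revert n2 n3 <;> decide

theorem sg_of_fixed (h : ℕ+ ≃ₜ ℕ+) {p : ℕ} (hp : p.Prime) (H : h p.toPNat' = p.toPNat') :
    sg h p = p := by
  rw [sg, H, toP hp, hp.minFac_eq]

theorem sg_five (h : ℕ+ ≃ₜ ℕ+) : sg h 5 = 5 := sg_of_fixed h (by norm_num) (homeo_five h)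

theorem level_full (h : ℕ+ ≃ₜ ℕ+) {p : ℕ} (hp : p.Prime) (n : ℕ) (hn : 1 ≤ n)
    {x : ℕ+} (hx : (x : ℕ) ≡ 1 [MOD p ^ n]) : (h x : ℕ) ≡ 1 [MOD sg h p ^ n] := by
  by_cases hp2 : p = 2 ∧ n < 3
  · obtain ⟨rfl, hn3⟩ := hp2
    rw [sg_two]
    have : n = 1 ∨ n = 2 := by omega
    rcases this with rfl | rfl
    · rw [pow_one] at hx ⊢
      have h1 : ¬ 2 ∣ (x : ℕ) := by
        simp only [Nat.ModEq] at hx; omega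
      rw [← sg_dvd_iff h Nat.prime_two, sg_two] at h1
      simp only [Nat.ModEq]; omega
    · have ex := cl_exact Nat.prime_two (n := 2) (q := 5) (by norm_num) (by decide) (by decide)
      rw [← ex] at hx ⊢
      have := hx.homeo h Nat.prime_two (by norm_num) (by norm_num)
      rwa [sg_two, sg_five] at this
  · exact level_all h hp hn (fun e => by push Not at hp2; exact hp2 e) hx

/-- The Golomb space is topologically rigid. -/
theorem homeo_eq_id (h : ℕ+ ≃ₜ ℕ+) (x : ℕ+) : h x = x := by
  induction x using PNat.strongInductionOn with
  | _ x ih =>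
  by_cases hx1 : x = 1
  · rw [hx1, homeo_one]
  have hxpos := x.pos
  have hx1' : (x : ℕ) ≠ 1 := fun e => hx1 (PNat.coe_injective e)
  have hhpos := (h x).pos
  have fix : ∀ p : ℕ, p.Prime → p < x → sg h p = p := by
    intro p hp hpx
    apply sg_of_fixed h hp
    apply ih
    rw [← PNat.coe_lt_coe, toP hp]
    exact hpx
  have modd : ∀ {N d : ℕ}, 1 ≤ N → (d ∣ N - 1 ↔ N ≡ 1 [MOD d]) := by
    intro N d hN
    rw [← Nat.modEq_iff_dvd' hN]
    exact ⟨Nat.ModEq.symm, Nat.ModEq.symm⟩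
  have key : (x : ℕ) - 1 = (h x : ℕ) - 1 := by
    apply Nat.dvd_antisymm
    · rw [Nat.dvd_iff_prime_pow_dvd_dvd]
      intro p k hp hpk
      rcases Nat.eq_zero_or_pos k with rfl | hk
      · simp
      have hle := Nat.le_of_dvd (by omega) ((dvd_pow_self p hk.ne').trans hpk)
      rw [modd hxpos] at hpk
      rw [modd hhpos]
      have := level_full h hp k hk hpk
      rwa [fix p hp (by omega)] at this
    · rw [Nat.dvd_iff_prime_pow_dvd_dvd]
      intro p k hp hpk
      rcases Nat.eq_zero_or_pos k with rfl | hk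
      · simp
      rw [modd hhpos] at hpk
      have h1 := level_full h.symm hp k hk hpk
      rw [Homeomorph.symm_apply_apply, ← modd hxpos] at h1
      have hp' := sg_prime h.symm hp
      have hle := Nat.le_of_dvd (by omega) ((dvd_pow_self _ hk.ne').trans h1)
      have h2 := fix _ hp' (by omega)
      rw [sg_symm' h hp] at h2
      rwa [← h2] at h1
  apply PNat.coe_injective
  omega

theorem golomb_homeo_monogenic (h : ℕ+ ≃ₜ ℕ+) (a : ℕ+) :
    h '' {x : ℕ+ | ∃ n : ℕ, 1 ≤ n ∧ x = a ^ n} =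
      {x : ℕ+ | ∃ n : ℕ, 1 ≤ n ∧ x = (h a) ^ n} := by
  have hid : (h : ℕ+ → ℕ+) = id := funext (homeo_eq_id h)
  rw [hid, Set.image_id]
  rfl
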